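/- Additive linear logic is not safe for the axioms (WR, A, N): there exist an agenda Φ of ALL formulas (namely Φ = {p, ¬p, p&q, ¬(p&q)} for distinct atoms p, q), n = 3 agents, an aggregator F on profiles of robustly consistent and complete judgment sets over Φ satisfying weak rationality, anonymity and neutrality (namely φ ∈ F(J) iff |N_φ| ≤ 1), and a profile J (namely J_1 = {¬p, ¬(p&q)}, J_2 = {p, p&q}, J_3 = {p, ¬(p&q)}) such that F(J) = {¬p, p&q} is ALL-inconsistent. -/

import Mathlib

namespace Stmt16

/-- Formulas of additive linear logic (ALL): atoms, linear negation, & and ⊕, no units. -/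
inductive AForm : Type
  | atom  : ℕ → AForm
  | neg   : AForm → AForm
  | awith : AForm → AForm → AForm         -- &
  | aplus : AForm → AForm → AForm         -- ⊕
  deriving DecidableEq

/-- Two-sided sequent calculus for ALL on multisets (no weakening, no contraction). -/
inductive ADeriv : Multiset AForm → Multiset AForm → Prop
  | ax (A) : ADeriv {A} {A}
  | cut {Γ Δ Γ' Δ' A} : ADeriv (A ::ₘ Γ) Δ → ADeriv Γ' (A ::ₘ Δ') →
      ADeriv (Γ + Γ') (Δ + Δ')
  | negL {Γ Δ A} : ADeriv Γ (A ::ₘ Δ) → ADeriv (AForm.neg A ::ₘ Γ) Δ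
  | negR {Γ Δ A} : ADeriv (A ::ₘ Γ) Δ → ADeriv Γ (AForm.neg A ::ₘ Δ)
  | withR {Γ Δ A B} : ADeriv Γ (A ::ₘ Δ) → ADeriv Γ (B ::ₘ Δ) →
      ADeriv Γ (AForm.awith A B ::ₘ Δ)
  | withL1 {Γ Δ A B} : ADeriv (A ::ₘ Γ) Δ → ADeriv (AForm.awith A B ::ₘ Γ) Δ
  | withL2 {Γ Δ A B} : ADeriv (B ::ₘ Γ) Δ → ADeriv (AForm.awith A B ::ₘ Γ) Δ
  | plusL {Γ Δ A B} : ADeriv (A ::ₘ Γ) Δ → ADeriv (B ::ₘ Γ) Δ →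
      ADeriv (AForm.aplus A B ::ₘ Γ) Δ
  | plusR1 {Γ Δ A B} : ADeriv Γ (A ::ₘ Δ) → ADeriv Γ (AForm.aplus A B ::ₘ Δ)
  | plusR2 {Γ Δ A B} : ADeriv Γ (B ::ₘ Δ) → ADeriv Γ (AForm.aplus A B ::ₘ Δ)

/-- ALL-inconsistency: Γ ⊢ (empty succedent) is derivable. -/
def AInconsistent (Γ : Multiset AForm) : Prop := ADeriv Γ 0

/-- Robust consistency in ALL: every submultiset is ALL-consistent. -/
def robustlyConsistent (Γ : Multiset AForm) : Prop :=
  ∀ Δ : Multiset AForm, Δ ≤ Γ → ¬ AInconsistent Δ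

/-- The complement ∼φ. -/
def AForm.compl : AForm → AForm
  | .neg ψ => ψ
  | φ      => .neg φ

def completeOn (Φ J : Finset AForm) : Prop := ∀ φ ∈ Φ, φ ∈ J ∨ φ.compl ∈ J

def complementFree (J : Finset AForm) : Prop := ∀ φ ∈ J, φ.compl ∉ J

def nsupp (n : ℕ) (J : Fin n → Finset AForm) (φ : AForm) : ℕ :=
  (Finset.univ.filter (fun i => φ ∈ J i)).card

/-- The majority rule. -/
def maj (n : ℕ) (Φ : Finset AForm) (J : Fin n → Finset AForm) : Finset AForm :=
  Φ.filter (fun φ => n < 2 * nsupp n J φ)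

/-- Profiles of robustly consistent and complete judgment sets over Φ. -/
def ratProfile (n : ℕ) (Φ : Finset AForm) (J : Fin n → Finset AForm) : Prop :=
  ∀ i, J i ⊆ Φ ∧ robustlyConsistent (J i).val ∧ completeOn Φ (J i)

section Axioms

variable (n : ℕ) (Φ : Finset AForm) (F : (Fin n → Finset AForm) → Finset AForm)

def anonymous : Prop :=
  ∀ J, ratProfile n Φ J → ∀ σ : Equiv.Perm (Fin n), F (fun i => J (σ i)) = F J

def neutral : Prop :=
  ∀ J, ratProfile n Φ J → ∀ φ ∈ Φ, ∀ ψ ∈ Φ,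
    (∀ i, φ ∈ J i ↔ ψ ∈ J i) → (φ ∈ F J ↔ ψ ∈ F J)

def weaklyRational : Prop :=
  ∀ J, ratProfile n Φ J → completeOn Φ (F J) ∧ complementFree (F J)

end Axioms

def p : AForm := .atom 0
def q : AForm := .atom 1

/-- The agenda {p, ¬p, p&q, ¬(p&q)}. -/
def Φ : Finset AForm := {p, .neg p, p.awith q, .neg (p.awith q)}

/-- The profile J₁ = {¬p, ¬(p&q)}, J₂ = {p, p&q}, J₃ = {p, ¬(p&q)}. -/
def Jprof : Fin 3 → Finset AForm := fun i =>
  if i = 0 then {.neg p, .neg (p.awith q)}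
  else if i = 1 then {p, p.awith q}
  else {p, .neg (p.awith q)}

/-- Boolean evaluation of formulas. -/
def evalB (v : ℕ → Prop) : AForm → Prop
  | .atom n => v n
  | .neg A => ¬ evalB v A
  | .awith A B => evalB v A ∧ evalB v B
  | .aplus A B => evalB v A ∨ evalB v B

/-- Classical soundness of the ALL sequent calculus. -/
theorem sound (v : ℕ → Prop) {Γ Δ : Multiset AForm} (h : ADeriv Γ Δ) :
    (∀ A ∈ Γ, evalB v A) → ∃ B ∈ Δ, evalB v B := by
  induction h with
  | ax A => simp
  | cut _ _ ih1 ih2 =>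
    intro hyp
    simp only [Multiset.mem_add, Multiset.mem_cons] at *
    grind
  | _ =>
    simp only [Multiset.mem_cons, forall_eq_or_imp, exists_eq_or_imp, evalB] at *
    grind

theorem robust_of_sat (v : ℕ → Prop) (Γ : Multiset AForm) (h : ∀ A ∈ Γ, evalB v A) :
    robustlyConsistent Γ := by
  intro Δ hle hd
  obtain ⟨B, hB, _⟩ := sound v hd (fun A hA => h A (Multiset.mem_of_le hle hA))
  simp at hB

theorem incons_pair (A : AForm) : AInconsistent (AForm.neg A ::ₘ {A}) :=
  ADeriv.negL (ADeriv.ax A)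

theorem not_both {J : Finset AForm} (h : robustlyConsistent J.val) (A : AForm)
    (h1 : A ∈ J) (h2 : AForm.neg A ∈ J) : False := by
  refine h _ ?_ (incons_pair A)
  rw [Multiset.le_iff_subset]
  · intro x hx
    simp at hx
    rcases hx with rfl | rfl <;> assumption
  · rw [Multiset.nodup_cons]
    refine ⟨?_, Multiset.nodup_singleton A⟩
    intro hm
    have := congrArg sizeOf (Multiset.mem_singleton.1 hm)
    simp at this

theorem compl_mem {φ : AForm} (h : φ ∈ Φ) : φ.compl ∈ Φ := by
  simp only [Φ, Finset.mem_insert, Finset.mem_singleton] at h ⊢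
  rcases h with rfl | rfl | rfl | rfl <;> simp [AForm.compl, p]

theorem mem_compl_iff {J : Finset AForm} (hr : robustlyConsistent J.val)
    (hc : completeOn Φ J) {φ : AForm} (h : φ ∈ Φ) : φ.compl ∈ J ↔ ¬ φ ∈ J := by
  constructor
  · intro h1 h2
    cases φ with
    | neg A => exact not_both hr A h1 h2
    | _ => exact not_both hr _ h2 h1
  · intro h1
    exact (hc φ h).resolve_left h1

theorem nsupp_compl {J : Fin 3 → Finset AForm} (hJ : ratProfile 3 Φ J) {φ : AForm}
    (h : φ ∈ Φ) : nsupp 3 J φ + nsupp 3 J φ.compl = 3 := by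
  unfold nsupp
  have : (Finset.univ.filter (fun i => φ.compl ∈ J i))
      = Finset.univ.filter (fun i => ¬ φ ∈ J i) := by
    ext i
    simp [mem_compl_iff (hJ i).2.1 (hJ i).2.2 h]
  rw [this, Finset.card_filter_add_card_filter_not]
  simp

/-- ALL is not safe for (WR, A, N): on the agenda {p,¬p,p&q,¬(p&q)} with
n = 3, the aggregator accepting φ iff at most one agent accepts it satisfies WR, A and
N, yet on the profile J₁ = {¬p,¬(p&q)}, J₂ = {p,p&q}, J₃ = {p,¬(p&q)} its outcome is
{¬p, p&q}, which is ALL-inconsistent. -/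
theorem all_not_safe_for_WR_A_N :
    ∃ F : (Fin 3 → Finset AForm) → Finset AForm,
      (∀ J, ratProfile 3 Φ J → ∀ φ ∈ Φ, (φ ∈ F J ↔ nsupp 3 J φ ≤ 1)) ∧
      (∀ J, ratProfile 3 Φ J → F J ⊆ Φ) ∧
      weaklyRational 3 Φ F ∧ anonymous 3 Φ F ∧ neutral 3 Φ F ∧
      ratProfile 3 Φ Jprof ∧
      F Jprof = {AForm.neg p, p.awith q} ∧
      AInconsistent ({AForm.neg p, p.awith q} : Finset AForm).val := by
  refine ⟨fun J => Φ.filter (fun φ => nsupp 3 J φ ≤ 1), ?_, ?_, ?_, ?_, ?_, ?_, ?_, ?_⟩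
  · intro J _ φ hφ
    simp [hφ]
  · intro J _
    exact Finset.filter_subset _ _
  · intro J hJ
    constructor
    · intro φ hφ
      have := nsupp_compl hJ hφ
      simp only [Finset.mem_filter, hφ, compl_mem hφ, true_and]
      omega
    · intro φ hφ
      simp only [Finset.mem_filter] at hφ ⊢
      have := nsupp_compl hJ hφ.1
      omega
  · intro J _ σ
    ext φ
    have : nsupp 3 (fun i => J (σ i)) φ = nsupp 3 J φ := by
      unfold nsupp
      exact Finset.card_equiv σ (by simp)
    simp [this]
  · intro J _ φ hφ ψ hψ h
    have : nsupp 3 J φ = nsupp 3 J ψ := by simp [nsupp, h]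
    simp [hφ, hψ, this]
  · intro i
    fin_cases i
    · refine ⟨by decide, robust_of_sat (fun _ => False) _ ?_, by unfold completeOn; decide⟩
      simp [Jprof, evalB, p, q]
    · refine ⟨by decide, robust_of_sat (fun _ => True) _ ?_, by unfold completeOn; decide⟩
      simp [Jprof, evalB, p, q]
    · refine ⟨by decide, robust_of_sat (fun n => n = 0) _ ?_, by unfold completeOn; decide⟩
      simp [Jprof, evalB, p, q]
  · decide
  · have h : ADeriv (p.awith q ::ₘ {AForm.neg p}) 0 := by
      apply ADeriv.withL1
      have := incons_pair p
      rw [AInconsistent, ← Multiset.singleton_add, add_comm, Multiset.singleton_add] at this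
      exact this
    have e : ({AForm.neg p, p.awith q} : Finset AForm).val
        = p.awith q ::ₘ {AForm.neg p} := by decide
    rw [AInconsistent, e]
    exact h

end Stmt16
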